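/- Let K be a skew field, G a locally indicable group, K*G a crossed product, and D₁, D₂ two Hughes-free fields of fractions for K*G. Then there is a ring isomorphism D₁ → D₂ which is the identity on K*G. -/

import Mathlib

/-- A subring `D` of `S` is division closed. -/
def IsDivisionClosed {S : Type*} [Ring S] (D : Subring S) : Prop :=
  ∀ x ∈ D, IsUnit x → ∃ y ∈ D, x * y = 1 ∧ y * x = 1

/-- The division closure of `R` in `S`. -/
def divisionClosure {S : Type*} [Ring S] (R : Subring S) : Subring S :=
  sInf {D | R ≤ D ∧ IsDivisionClosed D}

/-- `A` is a crossed product `K*G`. -/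
structure IsCrossedProduct (K : Type*) [DivisionRing K] (G : Type*) [Group G]
    (A : Type*) [Ring A] (ι : K →+* A) (u : G → Aˣ) : Prop where
  free : ∀ a : A, ∃! d : G →₀ K, a = d.sum fun g c => ι c * (u g : A)
  twist : ∀ g h : G, ∃ c : Kˣ, (u g : A) * (u h : A) = ι c * (u (g * h) : A)
  conj₁ : ∀ (g : G) (c : K), ∃ c' : K, (u g : A) * ι c = ι c' * (u g : A)
  conj₂ : ∀ (g : G) (c : K), ∃ c' : K, ι c * (u g : A) = (u g : A) * ι c'

/-- A group is locally indicable if every nontrivial finitely generated subgroup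
surjects onto an infinite cyclic group. -/
def LocallyIndicable (G : Type*) [Group G] : Prop :=
  ∀ H : Subgroup G, H ≠ ⊥ → Group.FG H →
    ∃ N : Subgroup H, ∃ hn : N.Normal,
      letI : N.Normal := hn
      Nonempty ((H ⧸ N) ≃* Multiplicative ℤ)

/-- `j : A → D` realizes `D` as a field of fractions for (the image of) `A`:
`j` is injective and the division closure of `j(A)` in `D` is all of `D`. -/
def IsFieldOfFractions {A D : Type*} [Ring A] [DivisionRing D] (j : A →+* D) :
    Prop :=
  Function.Injective j ∧ divisionClosure j.range = ⊤

/-- `D` (via `j : K*G → D`) is a Hughes-free field of fractions for the crossed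
product `K*G`: whenever `N ⊴ H ≤ G` with `H/N` infinite cyclic and `t ∈ H`
generates `H` mod `N`, the powers `{u_t^i | i ∈ ℤ}` are linearly independent over
the division closure of `K*N` in `D`. -/
def HughesFree {K G A D : Type*} [DivisionRing K] [Group G] [Ring A]
    [DivisionRing D] (ι : K →+* A) (u : G → Aˣ) (j : A →+* D) : Prop :=
  ∀ (H : Subgroup G) (N : Subgroup H) (hn : N.Normal) (t : H),
    (letI : N.Normal := hn
     Nonempty ((H ⧸ N) ≃* Multiplicative ℤ)) →
    (letI : N.Normal := hn
     Subgroup.zpowers ((QuotientGroup.mk t : H ⧸ N)) = ⊤) →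
    ∀ c : ℤ →₀ D,
      (∀ i : ℤ, c i ∈ divisionClosure ((Subring.closure
          (Set.range ι ∪ {x : A | ∃ g : H, g ∈ N ∧ x = (u (g : G) : A)})).map j)) →
      (c.sum fun i a => a * (j (u (t : G) : A)) ^ i) = 0 → c = 0

/-- The natural (Hessenberg) sum. -/
noncomputable def naturalSum (a b : Ordinal.{0}) : Ordinal.{0} :=
  max (⨆ x : Set.Iio a, Order.succ (naturalSum x.1 b))
    (⨆ x : Set.Iio b, Order.succ (naturalSum a x.1))
termination_by (a, b)
decreasing_by
  · exact Prod.Lex.left _ _ x.2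
  · exact Prod.Lex.right _ x.2

theorem naturalSum_lt_left {a a' : Ordinal.{0}} (h : a' < a) (b : Ordinal.{0}) :
    naturalSum a' b < naturalSum a b := by
  conv_rhs => rw [naturalSum]
  exact (Order.lt_succ _).trans_le (le_max_of_le_left
    (Ordinal.le_iSup (fun x : Set.Iio a => Order.succ (naturalSum x.1 b)) ⟨a', h⟩))

theorem naturalSum_lt_right (a : Ordinal.{0}) {b b' : Ordinal.{0}} (h : b' < b) :
    naturalSum a b' < naturalSum a b := by
  conv_rhs => rw [naturalSum]
  exact (Order.lt_succ _).trans_le (le_max_of_le_right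
    (Ordinal.le_iSup (fun x : Set.Iio b => Order.succ (naturalSum a x.1)) ⟨b', h⟩))

theorem naturalSum_strictMono_left (b : Ordinal.{0}) : StrictMono fun a => naturalSum a b :=
  fun _ _ h => naturalSum_lt_left h b

theorem naturalSum_strictMono_right (a : Ordinal.{0}) : StrictMono (naturalSum a) :=
  fun _ _ h => naturalSum_lt_right a h

theorem naturalSum_mono {a a' b b' : Ordinal.{0}} (h : a ≤ a') (h' : b ≤ b') :
    naturalSum a b ≤ naturalSum a' b' :=
  ((naturalSum_strictMono_left b).monotone h).trans ((naturalSum_strictMono_right a').monotone h')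

theorem le_naturalSum_left (a b : Ordinal.{0}) : a ≤ naturalSum a b :=
  (naturalSum_strictMono_left b).le_apply

theorem le_naturalSum_right (a b : Ordinal.{0}) : b ≤ naturalSum a b :=
  (naturalSum_strictMono_right a).le_apply

theorem exists_strictMono_isPrincipal (op : Ordinal.{0} → Ordinal.{0} → Ordinal.{0}) :
    ∃ f : Ordinal.{0} → Ordinal.{0}, StrictMono f ∧
      ∀ a, 1 < f a ∧ Ordinal.IsPrincipal op (f a) := by
  have hs : ¬ BddAbove {o | 1 < o ∧ Ordinal.IsPrincipal op o} := by
    rintro ⟨B, hB⟩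
    refine Ordinal.not_bddAbove_setOfPred_isPrincipal op ⟨max B 1, fun o ho => ?_⟩
    rcases le_or_gt o 1 with h | h
    · exact le_max_of_le_right h
    · exact le_max_of_le_left (hB ⟨h, ho⟩)
  exact ⟨Ordinal.enumOrd _, Ordinal.enumOrd_strictMono hs, fun a => Ordinal.enumOrd_mem hs a⟩

section LaurentSeriesExpansion

variable {D : Type*} [DivisionRing D]

theorem HahnSeries.exists_mul_eq_one_of_ne_zero (X : HahnSeries ℤ D) (hX : X ≠ 0) :
    ∃ Y, X * Y = 1 := by
  have h0 : PowerSeries.constantCoeff (LaurentSeries.powerSeriesPart X) ≠ 0 := by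
    rw [← PowerSeries.coeff_zero_eq_constantCoeff_apply, LaurentSeries.powerSeriesPart_coeff]
    simpa using hX
  refine ⟨HahnSeries.ofPowerSeries ℤ D
    (PowerSeries.invOfUnit (LaurentSeries.powerSeriesPart X) (Units.mk0 _ h0)) *
    HahnSeries.single (-X.order) 1, ?_⟩
  rw [← mul_assoc]
  nth_rewrite 1 [← LaurentSeries.single_order_mul_powerSeriesPart X]
  rw [mul_assoc (HahnSeries.single _ _), ← map_mul, PowerSeries.mul_invOfUnit _ _ rfl,
    map_one (HahnSeries.ofPowerSeries ℤ D), mul_one, HahnSeries.single_mul_single]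
  simp

/-- Convolution formula with an explicit finite range of summation. -/
theorem HahnSeries.coeff_mul_eq_sum_Icc (X Y : HahnSeries ℤ D) (a b n : ℤ)
    (hX : ∀ i < a, X.coeff i = 0) (hY : ∀ i < n - b, Y.coeff i = 0) :
    (X * Y).coeff n = ∑ i ∈ Finset.Icc a b, X.coeff i * Y.coeff (n - i) := by
  classical
  rw [HahnSeries.coeff_mul]
  refine Finset.sum_bij_ne_zero (fun ij _ _ => ij.1) ?_ ?_ ?_ ?_
  · rintro ⟨i, j⟩ h1 h2
    simp only [Finset.mem_antidiagonal, HahnSeries.mem_support] at h1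
    rw [Finset.mem_Icc]
    constructor
    · by_contra hlt
      exact h1.1 (hX _ (not_le.mp hlt))
    · by_contra hlt
      exact h1.2.1 (hY _ (by grind))
  · rintro ⟨i, j⟩ h1 _ ⟨i', j'⟩ h1' _ h
    simp only [Finset.mem_antidiagonal] at h1 h1'
    grind
  · intro i _ hne
    refine ⟨(i, n - i), ?_, hne, rfl⟩
    simp only [Finset.mem_antidiagonal, HahnSeries.mem_support]
    exact ⟨left_ne_zero_of_mul hne, right_ne_zero_of_mul hne, by ring⟩
  · rintro ⟨i, j⟩ h1 _
    simp only [Finset.mem_antidiagonal] at h1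
    rw [show n - i = j by grind]

/-- Ore localization inside a product of two domains: if `P` satisfies the left Ore condition and
either coordinate of an element of `P` vanishes only with the other, then so does the set of left
fractions. -/
theorem exists_subring_of_ore {L : Type*} [Ring L] [NoZeroDivisors L] [Nontrivial L]
    (hL : ∀ X : L, X ≠ 0 → ∃ Y, X * Y = 1) (P : Subring (D × L))
    (hP : ∀ p ∈ P, p.1 = 0 ↔ p.2 = 0)
    (hore : ∀ p ∈ P, ∀ q ∈ P, ∃ a ∈ P, ∃ b ∈ P, (a.1 ≠ 0 ∨ b.1 ≠ 0) ∧ a * p = b * q) :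
    ∃ S : Subring (D × L), P ≤ S ∧ (∀ z ∈ S, z.1 = 0 ↔ z.2 = 0) ∧
      ∀ z ∈ S, z.1 ≠ 0 → ∃ z' ∈ S, z * z' = 1 := by
  have key : ∀ p ∈ P, ∀ q ∈ P, p.1 ≠ 0 → q.1 ≠ 0 →
      ∃ a ∈ P, ∃ b ∈ P, a.1 ≠ 0 ∧ b.1 ≠ 0 ∧ a * p = b * q := by
    intro p hp q hq hp0 hq0
    obtain ⟨a, ha, b, hb, hab, h⟩ := hore p hp q hq
    have h1 : a.1 * p.1 = b.1 * q.1 := congrArg Prod.fst h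
    refine ⟨a, ha, b, hb, ?_, ?_, h⟩
    · intro h0
      rcases hab with h' | h'
      · exact h' h0
      · rw [h0, zero_mul] at h1
        exact (mul_ne_zero h' hq0) h1.symm
    · intro h0
      rcases hab with h' | h'
      · rw [h0, zero_mul] at h1
        exact (mul_ne_zero h' hp0) h1
      · exact h' h0
  have hzero : ∀ z : D × L, ∀ q ∈ P, ∀ p ∈ P, q.1 ≠ 0 → q * z = p →
      ((z.1 = 0 ↔ p.1 = 0) ∧ (z.2 = 0 ↔ p.2 = 0)) := by
    rintro z q hq p hp hq0 rfl
    have hq2 : q.2 ≠ 0 := fun h => hq0 ((hP q hq).2 h)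
    simp [hq0, hq2]
  let S : Subring (D × L) :=
    { carrier := {z | ∃ q ∈ P, ∃ p ∈ P, q.1 ≠ 0 ∧ q * z = p}
      zero_mem' := ⟨1, P.one_mem, 0, P.zero_mem, by simp, by simp⟩
      one_mem' := ⟨1, P.one_mem, 1, P.one_mem, by simp, by simp⟩
      add_mem' := by
        rintro z z' ⟨q, hq, p, hp, hq0, h⟩ ⟨q', hq', p', hp', hq0', h'⟩
        obtain ⟨a, ha, b, hb, ha0, hb0, hab⟩ := key q hq q' hq' hq0 hq0'
        refine ⟨a * q, P.mul_mem ha hq, a * p + b * p',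
          P.add_mem (P.mul_mem ha hp) (P.mul_mem hb hp'), mul_ne_zero ha0 hq0, ?_⟩
        rw [mul_add, mul_assoc, h]
        congr 1
        rw [hab, mul_assoc, h']
      neg_mem' := by
        rintro z ⟨q, hq, p, hp, hq0, h⟩
        exact ⟨q, hq, -p, P.neg_mem hp, hq0, by rw [mul_neg, h]⟩
      mul_mem' := by
        rintro z z' ⟨q, hq, p, hp, hq0, h⟩ ⟨q', hq', p', hp', hq0', h'⟩
        by_cases hp0 : p.1 = 0
        · obtain ⟨e1, e2⟩ := hzero z q hq p hp hq0 h
          have : z = 0 := Prod.ext (e1.2 hp0) (e2.2 ((hP p hp).1 hp0))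
          exact ⟨1, P.one_mem, 0, P.zero_mem, by simp, by simp [this]⟩
        · obtain ⟨a, ha, b, hb, ha0, hb0, hab⟩ := key p hp q' hq' hp0 hq0'
          refine ⟨a * q, P.mul_mem ha hq, b * p', P.mul_mem hb hp', mul_ne_zero ha0 hq0, ?_⟩
          rw [mul_assoc a, ← mul_assoc q, h, ← mul_assoc a, hab, mul_assoc, h'] }
  refine ⟨S, fun p hp => ⟨1, P.one_mem, p, hp, by simp, by simp⟩, ?_, ?_⟩
  · rintro z ⟨q, hq, p, hp, hq0, h⟩
    obtain ⟨e1, e2⟩ := hzero z q hq p hp hq0 h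
    rw [e1, e2, hP p hp]
  · rintro z ⟨q, hq, p, hp, hq0, h⟩ hz
    obtain ⟨e1, e2⟩ := hzero z q hq p hp hq0 h
    have hp0 : p.1 ≠ 0 := fun h0 => hz (e1.2 h0)
    have hp2 : p.2 ≠ 0 := fun h0 => hp0 ((hP p hp).2 h0)
    have hq2 : q.2 ≠ 0 := fun h0 => hq0 ((hP q hq).2 h0)
    obtain ⟨Y, hY⟩ := hL p.2 hp2
    refine ⟨(p.1⁻¹ * q.1, Y * q.2), ⟨p, hp, q, hq, hp0, ?_⟩, ?_⟩
    · ext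
      · simp [hp0]
      · simp [← mul_assoc, hY]
    · ext
      · have h1 : q.1 * z.1 = p.1 := congrArg Prod.fst h
        apply mul_left_cancel₀ hq0
        simp [← mul_assoc, h1, hp0]
      · have h1 : q.2 * z.2 = p.2 := congrArg Prod.snd h
        apply mul_left_cancel₀ hq2
        simp [← mul_assoc, h1, hY]

/-- The ring of twisted Laurent polynomials `∑ cₙ τⁿ sⁿ` with `cₙ ∈ F`, where `s` is a central
indeterminate. -/
def twistedLaurent (F : Subfield D) (τ : D) (hτ0 : τ ≠ 0)
    (hτ : ∀ n : ℤ, ∀ x ∈ F, τ ^ n * x * τ ^ (-n) ∈ F) : Subring (AddMonoidAlgebra D ℤ) where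
  carrier := {X | ∀ n, X.coeff n * τ ^ (-n) ∈ F}
  zero_mem' n := by simp
  one_mem' n := by
    classical
    rw [AddMonoidAlgebra.one_def, AddMonoidAlgebra.coeff_single, Finsupp.single_apply]
    split_ifs with h
    · subst h; simp
    · simp
  add_mem' hX hY n := by
    rw [AddMonoidAlgebra.coeff_add, Finsupp.add_apply, add_mul]
    exact F.add_mem (hX n) (hY n)
  neg_mem' {X} hX n := by
    have : (-X).coeff n = -(X.coeff n) := rfl
    rw [this, neg_mul]
    exact F.neg_mem (hX n)
  mul_mem' {X Y} hX hY n := by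
    classical
    rw [AddMonoidAlgebra.coeff_mul, Finsupp.sum, Finset.sum_mul]
    refine F.sum_mem fun i _ => ?_
    rw [Finsupp.sum, Finset.sum_mul]
    refine F.sum_mem fun j _ => ?_
    split_ifs with h
    · subst h
      have := F.mul_mem (hX i) (hτ i _ (hY j))
      convert this using 1
      have e : τ ^ (-(i + j)) = τ ^ (-j) * τ ^ (-i) := by
        rw [← zpow_add₀ hτ0]; congr 1; ring
      have e2 : τ ^ (-i) * τ ^ i = 1 := by rw [← zpow_add₀ hτ0]; simp
      rw [e]
      calc _ = X.coeff i * 1 * Y.coeff j * (τ ^ (-j) * τ ^ (-i)) := by simp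
        _ = _ := by rw [← e2]; simp only [mul_assoc]
    · simp

theorem twistedLaurent_ore (F : Subfield D) (τ : D) (hτ0 : τ ≠ 0)
    (hτ : ∀ n : ℤ, ∀ x ∈ F, τ ^ n * x * τ ^ (-n) ∈ F)
    (p q : AddMonoidAlgebra D ℤ) (hp : p ∈ twistedLaurent F τ hτ0 hτ)
    (hq : q ∈ twistedLaurent F τ hτ0 hτ) :
    ∃ a ∈ twistedLaurent F τ hτ0 hτ, ∃ b ∈ twistedLaurent F τ hτ0 hτ,
      (a ≠ 0 ∨ b ≠ 0) ∧ a * p = b * q := by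
  classical
  obtain ⟨M, hM⟩ : ∃ M : ℕ, ∀ n : ℤ, (M : ℤ) < |n| → p.coeff n = 0 ∧ q.coeff n = 0 := by
    refine ⟨(p.coeff.support ∪ q.coeff.support).sup Int.natAbs, fun n hn => ?_⟩
    have : n ∉ p.coeff.support ∪ q.coeff.support := fun hmem => by
      have := Finset.le_sup (f := Int.natAbs) hmem
      rw [Int.abs_eq_natAbs] at hn
      omega
    rw [Finset.notMem_union, Finsupp.notMem_support_iff, Finsupp.notMem_support_iff] at this
    exact this
  have hmul : ∀ X ∈ twistedLaurent F τ hτ0 hτ, ∀ i n : ℤ,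
      τ ^ i * X.coeff (n - i) * τ ^ (-n) ∈ F := by
    intro X hX i n
    have := hτ i _ (hX (n - i))
    convert this using 1
    rw [mul_assoc, mul_assoc, mul_assoc, ← zpow_add₀ hτ0]
    congr 3; ring
  let r : (Fin (2 * M + 1) ⊕ Fin (2 * M + 1)) → AddMonoidAlgebra D ℤ :=
    Sum.elim (fun _ => p) fun _ => q
  let e : (Fin (2 * M + 1) ⊕ Fin (2 * M + 1)) → ℤ := Sum.elim (fun i => (i : ℕ)) fun i => (i : ℕ)
  have hr : ∀ s, r s ∈ twistedLaurent F τ hτ0 hτ := by rintro (s | s); exacts [hp, hq]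
  let v : (Fin (2 * M + 1) ⊕ Fin (2 * M + 1)) → (Fin (4 * M + 1) → F) := fun s k =>
    ⟨τ ^ e s * (r s).coeff (((k : ℕ) - M : ℤ) - e s) * τ ^ (-((k : ℕ) - M : ℤ)), hmul _ (hr s) _ _⟩
  have hdep : ¬ LinearIndependent F v := by
    intro h
    have := h.fintype_card_le_finrank
    simp at this
    omega
  obtain ⟨g, hg, s₀, hs₀⟩ := Fintype.not_linearIndependent_iff.1 hdep
  let T : (Fin (2 * M + 1) → F) → AddMonoidAlgebra D ℤ := fun c =>
    ∑ i : Fin (2 * M + 1), AddMonoidAlgebra.single ((i : ℕ) : ℤ) ((c i : D) * τ ^ ((i : ℕ) : ℤ))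
  have hT : ∀ c, T c ∈ twistedLaurent F τ hτ0 hτ := by
    intro c
    refine Subring.sum_mem _ fun i _ n => ?_
    rw [AddMonoidAlgebra.coeff_single, Finsupp.single_apply]
    split_ifs with h
    · subst h
      rw [mul_assoc, ← zpow_add₀ hτ0]
      simp
    · simp
  have hTc : ∀ c (i : Fin (2 * M + 1)), (T c).coeff ((i : ℕ) : ℤ) = c i * τ ^ ((i : ℕ) : ℤ) := by
    intro c i
    simp only [T, AddMonoidAlgebra.coeff_sum, Finsupp.finsetSum_apply,
      AddMonoidAlgebra.coeff_single, Finsupp.single_apply]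
    rw [Finset.sum_eq_single i]
    · simp
    · intro j _ hj
      rw [if_neg]
      intro h
      exact hj (Fin.ext (by exact_mod_cast h))
    · simp
  have hTm : ∀ c X n, (T c * X).coeff n = ∑ i : Fin (2 * M + 1),
      (c i : D) * τ ^ ((i : ℕ) : ℤ) * X.coeff (n - (i : ℕ)) := by
    intro c X n
    simp only [T, Finset.sum_mul, AddMonoidAlgebra.coeff_sum, Finsupp.finsetSum_apply,
      AddMonoidAlgebra.coeff_single_mul_apply]
    refine Finset.sum_congr rfl fun i _ => ?_
    rw [neg_add_eq_sub]
  refine ⟨T fun i => g (Sum.inl i), hT _, T fun i => - g (Sum.inr i), hT _, ?_, ?_⟩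
  · by_contra! hcon
    apply hs₀
    rcases s₀ with i | i
    · have := hTc (fun i => g (Sum.inl i)) i
      rw [hcon.1] at this
      simpa [hτ0] using this.symm
    · have := hTc (fun i => - g (Sum.inr i)) i
      rw [hcon.2] at this
      simpa [hτ0] using this.symm
  · rw [← sub_eq_zero]
    ext n
    have hsub : ∀ X Y : AddMonoidAlgebra D ℤ, (X - Y).coeff n = X.coeff n - Y.coeff n :=
      fun _ _ => rfl
    rw [hsub, hTm, hTm]
    simp only [NegMemClass.coe_neg, neg_mul, Finset.sum_neg_distrib, sub_neg_eq_add,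
      AddMonoidAlgebra.coeff_zero, Finsupp.zero_apply]
    by_cases hn : -(M : ℤ) ≤ n ∧ n ≤ 3 * M
    · have hk := congrArg (fun f => ((f ⟨(n + M).toNat, by omega⟩ : F) : D)) hg
      simp only [Finset.sum_apply, Fintype.sum_sum_type, Pi.smul_apply] at hk
      have hnM : (((n + M).toNat : ℤ) - M : ℤ) = n := by omega
      simp only [v, r, e, hnM, Sum.elim_inl, Sum.elim_inr] at hk
      have hk' := congrArg (· * τ ^ n) hk
      have hcancel : τ ^ (-n) * τ ^ n = 1 := by rw [← zpow_add₀ hτ0]; simp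
      simpa only [Finset.sum_mul, add_mul, smul_eq_mul, mul_assoc, hcancel, mul_one,
        Subfield.coe_add, AddSubmonoidClass.coe_finsetSum,
        Subfield.coe_mul, ZeroMemClass.coe_zero, zero_mul, Pi.zero_apply] using hk'
    · rw [Finset.sum_eq_zero, Finset.sum_eq_zero, add_zero]
      · intro i _
        rw [(hM (n - (i : ℕ)) (by have := i.2; rw [lt_abs]; omega)).2, mul_zero]
      · intro i _
        rw [(hM (n - (i : ℕ)) (by have := i.2; rw [lt_abs]; omega)).1, mul_zero]

/-- Evaluation at `s = 1` paired with the inclusion into Laurent series. -/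
noncomputable def evalOneProdLaurent (D : Type*) [DivisionRing D] :
    AddMonoidAlgebra D ℤ →+* D × HahnSeries ℤ D :=
  AddMonoidAlgebra.liftNCRingHom ((RingHom.id D).prod HahnSeries.C)
    { toFun := fun n => (1, HahnSeries.single n.toAdd 1)
      map_one' := rfl
      map_mul' := fun a b => by
        rw [Prod.mk_mul_mk, HahnSeries.single_mul_single]; simp }
    (by
      intro x y
      rw [commute_iff_eq]
      refine Prod.ext (by simp) ?_
      simp [HahnSeries.C_apply, HahnSeries.single_mul_single])

theorem evalOneProdLaurent_single (n : ℤ) (d : D) :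
    evalOneProdLaurent D (AddMonoidAlgebra.single n d) = (d, HahnSeries.single n d) := by
  rw [evalOneProdLaurent, AddMonoidAlgebra.liftNCRingHom_single]
  simp [HahnSeries.C_apply, HahnSeries.single_mul_single]

theorem evalOneProdLaurent_fst (X : AddMonoidAlgebra D ℤ) :
    (evalOneProdLaurent D X).1 = X.coeff.sum fun _ d => d := by
  induction X using AddMonoidAlgebra.induction_linear with
  | zero => simp
  | add X Y hX hY =>
    rw [map_add, Prod.fst_add, hX, hY, AddMonoidAlgebra.coeff_add,
      Finsupp.sum_add_index' (fun _ => rfl) (fun _ _ _ => rfl)]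
  | single n d =>
    rw [evalOneProdLaurent_single, AddMonoidAlgebra.coeff_single, Finsupp.sum_single_index rfl]

theorem evalOneProdLaurent_snd (X : AddMonoidAlgebra D ℤ) (n : ℤ) :
    (evalOneProdLaurent D X).2.coeff n = X.coeff n := by
  classical
  induction X using AddMonoidAlgebra.induction_linear with
  | zero => simp
  | add X Y hX hY =>
    rw [map_add, Prod.snd_add, HahnSeries.coeff_add, hX, hY, AddMonoidAlgebra.coeff_add,
      Finsupp.add_apply]
  | single m d =>
    rw [evalOneProdLaurent_single, AddMonoidAlgebra.coeff_single, HahnSeries.coeff_single,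
      Finsupp.single_apply]
    simp [eq_comm]

/-- If the powers of `τ` are linearly independent over a division subring `F` normalized by `τ`,
then the division ring generated by `F` and `τ` embeds in Laurent series over `D` with a central
variable `s`, fixing `F` and sending `τ` to `τ s`.  The embedding is presented by its graph. -/
theorem exists_laurent_expansion (F : Subfield D) (τ : D) (hτ0 : τ ≠ 0)
    (hτ : ∀ n : ℤ, ∀ x ∈ F, τ ^ n * x * τ ^ (-n) ∈ F)
    (hind : ∀ c : ℤ →₀ D, (∀ i, c i ∈ F) → (c.sum fun i a => a * τ ^ i) = 0 → c = 0) :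
    ∃ S : Subring (D × HahnSeries ℤ D),
      (∀ (n : ℤ) (d : D), d * τ ^ (-n) ∈ F → (d, HahnSeries.single n d) ∈ S) ∧
      (∀ z ∈ S, z.1 = 0 ↔ z.2 = 0) ∧ ∀ z ∈ S, z.1 ≠ 0 → ∃ z' ∈ S, z * z' = 1 := by
  classical
  have hinj : ∀ X ∈ twistedLaurent F τ hτ0 hτ, (evalOneProdLaurent D X).1 = 0 → X = 0 := by
    intro X hX h
    rw [evalOneProdLaurent_fst] at h
    let c : ℤ →₀ D := Finsupp.onFinset X.coeff.support (fun n => X.coeff n * τ ^ (-n))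
      (fun n hn => Finsupp.mem_support_iff.2 (left_ne_zero_of_mul hn))
    have hc : c = 0 := by
      refine hind c (fun i => hX i) ?_
      rw [Finsupp.onFinset_sum _ (by simp)]
      rw [← h, Finsupp.sum]
      refine Finset.sum_congr rfl fun n _ => ?_
      rw [mul_assoc, ← zpow_add₀ hτ0]
      simp
    ext n
    have := DFunLike.congr_fun hc n
    simpa [c, zpow_ne_zero n hτ0] using this
  obtain ⟨S, hPS, h1, h2⟩ := exists_subring_of_ore HahnSeries.exists_mul_eq_one_of_ne_zero
    ((twistedLaurent F τ hτ0 hτ).map (evalOneProdLaurent D)) (by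
      rintro _ ⟨X, hX, rfl⟩
      constructor
      · intro h
        rw [hinj X hX h, map_zero]; rfl
      · intro h
        have : X = 0 := by
          ext n
          rw [← evalOneProdLaurent_snd, h]; rfl
        rw [this, map_zero]; rfl) (by
      rintro _ ⟨p, hp, rfl⟩ _ ⟨q, hq, rfl⟩
      obtain ⟨a, ha, b, hb, hab, h⟩ := twistedLaurent_ore F τ hτ0 hτ p q hp hq
      refine ⟨_, ⟨a, ha, rfl⟩, _, ⟨b, hb, rfl⟩, ?_, by rw [← map_mul, ← map_mul, h]⟩
      exact hab.imp (fun h h' => h (hinj a ha h')) (fun h h' => h (hinj b hb h')))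
  refine ⟨S, fun n d hd => hPS ⟨AddMonoidAlgebra.single n d, fun m => ?_,
    evalOneProdLaurent_single n d⟩, h1, h2⟩
  rw [AddMonoidAlgebra.coeff_single, Finsupp.single_apply]
  split_ifs with h
  · exact h ▸ hd
  · simp

end LaurentSeriesExpansion

section Monomials

variable {K G A : Type*} [DivisionRing K] [Ring A] {ι : K →+* A} {u : G → Aˣ}

/-- The unit `w` of the crossed product is a nonzero scalar multiple of `u g`. -/
def IsMonomial (ι : K →+* A) (u : G → Aˣ) (w : Aˣ) (g : G) : Prop :=
  ∃ c : Kˣ, w = Units.map ι c * u g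

namespace IsMonomial

theorem of_group (g : G) : IsMonomial ι u (u g) g := ⟨1, by simp⟩

theorem neg {w : Aˣ} {g : G} (h : IsMonomial ι u w g) : IsMonomial ι u (-w) g := by
  obtain ⟨c, rfl⟩ := h
  refine ⟨-c, Units.ext ?_⟩
  simp

end IsMonomial

variable [Group G]

namespace IsCrossedProduct

theorem exists_conj_scalar (hA : IsCrossedProduct K G A ι u)
    (g : G) (c : Kˣ) : ∃ c' : Kˣ, u g * Units.map ι c = Units.map ι c' * u g := by
  obtain ⟨c', h'⟩ := hA.conj₁ g c
  have hne : c' ≠ 0 := by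
    rintro rfl
    have h0 : (u g * Units.map ι c : Aˣ) = (0 : A) := by simpa using h'
    have h1 : (1 : A) = 0 := by
      rw [← Units.mul_inv (u g * Units.map ι c), h0, zero_mul]
    have : Subsingleton A := subsingleton_of_zero_eq_one h1.symm
    obtain ⟨d, -, hd⟩ := hA.free 0
    have e1 := hd 0 (by simp)
    have e2 := hd (Finsupp.single 1 1) (Subsingleton.elim _ _)
    simpa using DFunLike.congr_fun (e2.trans e1.symm) 1
  exact ⟨Units.mk0 c' hne, Units.ext (by simpa using h')⟩

theorem exists_mul_scalar (hA : IsCrossedProduct K G A ι u)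
    (g h : G) : ∃ c : Kˣ, u g * u h = Units.map ι c * u (g * h) := by
  obtain ⟨c, hc⟩ := hA.twist g h
  exact ⟨c, Units.ext (by simpa using hc)⟩

theorem isMonomial_mul (hA : IsCrossedProduct K G A ι u)
    {v w : Aˣ} {g h : G} (hv : IsMonomial ι u v g) (hw : IsMonomial ι u w h) :
    IsMonomial ι u (v * w) (g * h) := by
  obtain ⟨c, rfl⟩ := hv
  obtain ⟨d, rfl⟩ := hw
  obtain ⟨d', hd'⟩ := hA.exists_conj_scalar g d
  obtain ⟨e, he⟩ := hA.exists_mul_scalar g h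
  refine ⟨c * d' * e, ?_⟩
  rw [map_mul, map_mul, mul_assoc, ← mul_assoc (u g), hd', mul_assoc _ (u g), he]
  simp only [mul_assoc]

theorem exists_group_one (hA : IsCrossedProduct K G A ι u) : ∃ c : Kˣ, u 1 = Units.map ι c := by
  obtain ⟨c, hc⟩ := hA.exists_mul_scalar 1 1
  rw [mul_one] at hc
  exact ⟨c, mul_right_cancel hc⟩

theorem eq_scalar_of_isMonomial_one (hA : IsCrossedProduct K G A ι u)
    {w : Aˣ} (h : IsMonomial ι u w 1) :
    ∃ c : Kˣ, w = Units.map ι c := by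
  obtain ⟨c, rfl⟩ := h
  obtain ⟨d, hd⟩ := hA.exists_group_one
  exact ⟨c * d, by rw [hd, map_mul]⟩

theorem isMonomial_scalar (hA : IsCrossedProduct K G A ι u)
    (c : Kˣ) : IsMonomial ι u (Units.map ι c) 1 := by
  obtain ⟨d, hd⟩ := hA.exists_group_one
  exact ⟨c * d⁻¹, by rw [hd, map_mul, map_inv, inv_mul_cancel_right]⟩

theorem isMonomial_one (hA : IsCrossedProduct K G A ι u) : IsMonomial ι u 1 1 := by
  simpa using hA.isMonomial_scalar 1

theorem isMonomial_inv (hA : IsCrossedProduct K G A ι u)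
    {w : Aˣ} {g : G} (h : IsMonomial ι u w g) : IsMonomial ι u w⁻¹ g⁻¹ := by
  obtain ⟨c, hc⟩ := hA.eq_scalar_of_isMonomial_one
    (by simpa using hA.isMonomial_mul (IsMonomial.of_group g⁻¹) h)
  have hw : w⁻¹ = Units.map ι c⁻¹ * u g⁻¹ := by
    rw [map_inv, ← hc]; group
  exact ⟨c⁻¹, hw⟩

theorem isMonomial_conj (hA : IsCrossedProduct K G A ι u)
    {v w : Aˣ} {g h : G} (hv : IsMonomial ι u v g) (hw : IsMonomial ι u w h) :
    IsMonomial ι u (v * w * v⁻¹) (g * h * g⁻¹) :=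
  hA.isMonomial_mul (hA.isMonomial_mul hv hw) (hA.isMonomial_inv hv)

theorem isMonomial_zpow (hA : IsCrossedProduct K G A ι u)
    {w : Aˣ} {g : G} (h : IsMonomial ι u w g) (n : ℤ) :
    IsMonomial ι u (w ^ n) (g ^ n) := by
  have hnat : ∀ n : ℕ, IsMonomial ι u (w ^ n) (g ^ n) := by
    intro n
    induction n with
    | zero => simpa using hA.isMonomial_one
    | succ n ih => simpa only [pow_succ] using hA.isMonomial_mul ih h
  obtain ⟨m, rfl | rfl⟩ := n.eq_nat_or_neg
  · simpa using hnat m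
  · simpa using hA.isMonomial_inv (hnat m)

/-- Conjugation by a monomial unit preserves the scalars. -/
theorem exists_conj_eq_scalar (hA : IsCrossedProduct K G A ι u)
    {w : Aˣ} {g : G} (h : IsMonomial ι u w g) (c : Kˣ) :
    ∃ c' : Kˣ, w * Units.map ι c * w⁻¹ = Units.map ι c' := by
  have := hA.isMonomial_conj h (hA.isMonomial_scalar c)
  rw [mul_one, mul_inv_cancel] at this
  exact hA.eq_scalar_of_isMonomial_one this

end IsCrossedProduct

end Monomials

section DivisionClosure

theorem le_divisionClosure {S : Type*} [Ring S] (R : Subring S) : R ≤ divisionClosure R :=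
  le_sInf fun _ h => h.1

theorem divisionClosure_le {S : Type*} [Ring S] {R T : Subring S} (h : R ≤ T)
    (hT : IsDivisionClosed T) : divisionClosure R ≤ T :=
  sInf_le ⟨h, hT⟩

variable {D : Type*} [DivisionRing D]

theorem inv_mem_divisionClosure {R : Subring D} {x : D} (hx : x ∈ divisionClosure R) :
    x⁻¹ ∈ divisionClosure R := by
  refine Subring.mem_sInf.2 fun T hT => ?_
  rcases eq_or_ne x 0 with rfl | h0
  · simp
  · obtain ⟨y, hy, hxy, -⟩ := hT.2 x (Subring.mem_sInf.1 hx T hT) h0.isUnit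
    rwa [← eq_inv_of_mul_eq_one_right hxy]

theorem isDivisionClosed_of_inv_mem {T : Subring D} (h : ∀ x ∈ T, x ≠ 0 → x⁻¹ ∈ T) :
    IsDivisionClosed T := fun x hx hu =>
  ⟨x⁻¹, h x hx hu.ne_zero, mul_inv_cancel₀ hu.ne_zero, inv_mul_cancel₀ hu.ne_zero⟩

/-- The division closure of a subring of a division ring, as a division subring. -/
def divisionClosureSubfield (R : Subring D) : Subfield D where
  __ := divisionClosure R
  inv_mem' _ := inv_mem_divisionClosure

theorem mem_divisionClosureSubfield {R : Subring D} {x : D} :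
    x ∈ divisionClosureSubfield R ↔ x ∈ divisionClosure R := Iff.rfl

/-- The division closure inherits invariance under conjugation. -/
theorem conj_mem_divisionClosure {R : Subring D} (a : Dˣ)
    (hR : ∀ x ∈ R, (a : D) * x * (a⁻¹ : Dˣ) ∈ divisionClosure R) {x : D}
    (hx : x ∈ divisionClosure R) : (a : D) * x * (a⁻¹ : Dˣ) ∈ divisionClosure R := by
  have hle := divisionClosure_le (R := R) (T := (divisionClosure R).comap
    (MulSemiringAction.toRingHom (ConjAct Dˣ) D (ConjAct.toConjAct a)))
    (fun x hx => by simpa [ConjAct.units_smul_def] using hR x hx)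
    (isDivisionClosed_of_inv_mem fun x hx _ => by
      rw [Subring.mem_comap, map_inv₀]
      exact inv_mem_divisionClosure hx)
  simpa [ConjAct.units_smul_def] using hle hx

end DivisionClosure

section Expansion

variable {K G A D : Type*} [DivisionRing K] [Group G] [Ring A] [DivisionRing D]
  {ι : K →+* A} {u : G → Aˣ} {j : A →+* D}

/-- The degree on `H` given by a homomorphism to `ℤ`, extended by zero. -/
noncomputable def subgroupDegree {H : Subgroup G} (φ : H →* Multiplicative ℤ) (g : G) : ℤ :=
  open Classical in if h : g ∈ H then (φ ⟨g, h⟩).toAdd else 0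

theorem subgroupDegree_coe {H : Subgroup G} (φ : H →* Multiplicative ℤ) (g : H) :
    subgroupDegree φ g = (φ g).toAdd := by
  simp [subgroupDegree]

theorem subgroupDegree_mul {H : Subgroup G} (φ : H →* Multiplicative ℤ) (g : G) (hg : g ∈ H)
    (h : G) (hh : h ∈ H) :
    subgroupDegree φ (g * h) = subgroupDegree φ g + subgroupDegree φ h := by
  lift g to H using hg
  lift h to H using hh
  rw [← Subgroup.coe_mul, subgroupDegree_coe, subgroupDegree_coe, subgroupDegree_coe, map_mul,
    toAdd_mul]

/-- `S` is the graph of a partial embedding of `D` into Laurent series with a central variable `s`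
which is defined on the division subring generated by `K*H`, fixes the scalars and multiplies
`u g` by `s ^ deg g`. -/
structure IsExpansion (ι : K →+* A) (u : G → Aˣ) (j : A →+* D) (H : Subgroup G) (deg : G → ℤ)
    (S : Subring (D × HahnSeries ℤ D)) : Prop where
  scalar_mem (k : K) : (j (ι k), HahnSeries.single 0 (j (ι k))) ∈ S
  group_mem (g : G) (hg : g ∈ H) : (j (u g), HahnSeries.single (deg g) (j (u g))) ∈ S
  eq_zero_iff (z : D × HahnSeries ℤ D) (hz : z ∈ S) : z.1 = 0 ↔ z.2 = 0
  exists_mul_eq_one (z : D × HahnSeries ℤ D) (hz : z ∈ S) (hz0 : z.1 ≠ 0) : ∃ z' ∈ S, z * z' = 1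

theorem HughesFree.exists_isExpansion (hj : HughesFree ι u j)
    (hA : IsCrossedProduct K G A ι u) (H : Subgroup G) (N : Subgroup H) [hN : N.Normal]
    (e : (H ⧸ N) ≃* Multiplicative ℤ) :
    ∃ S, IsExpansion ι u j H
      (subgroupDegree (e.toMonoidHom.comp (QuotientGroup.mk' N))) S := by
  set φ := e.toMonoidHom.comp (QuotientGroup.mk' N) with hφ
  have hφN : ∀ g : H, φ g = 1 ↔ g ∈ N := by
    intro g
    simp [hφ, QuotientGroup.eq_one_iff]
  obtain ⟨t, ht⟩ : ∃ t, φ t = Multiplicative.ofAdd 1 :=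
    (e.surjective.comp (QuotientGroup.mk'_surjective N)) _
  have htop : Subgroup.zpowers (QuotientGroup.mk t : H ⧸ N) = ⊤ := by
    rw [Subgroup.eq_top_iff']
    intro x
    refine ⟨(e x).toAdd, e.injective ?_⟩
    have : e (QuotientGroup.mk t) = Multiplicative.ofAdd 1 := ht
    simp only [map_zpow, this, ← ofAdd_zsmul, smul_eq_mul, mul_one, ofAdd_toAdd]
  set R := (Subring.closure
    (Set.range ι ∪ {x : A | ∃ g : H, g ∈ N ∧ x = (u (g : G) : A)})).map j with hR
  have hscalar : ∀ k, j (ι k) ∈ R := fun k =>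
    ⟨_, Subring.subset_closure (Or.inl ⟨k, rfl⟩), rfl⟩
  have hmono : ∀ (w : Aˣ) (g : H), g ∈ N → IsMonomial ι u w g → j w ∈ R := by
    rintro w g hg ⟨c, rfl⟩
    rw [Units.val_mul, map_mul]
    exact R.mul_mem (hscalar _) ⟨_, Subring.subset_closure (Or.inr ⟨g, hg, rfl⟩), rfl⟩
  have hconj : ∀ (w : Aˣ) (g : H), IsMonomial ι u w g → ∀ x ∈ divisionClosure R,
      j w * x * j (w⁻¹ : Aˣ) ∈ divisionClosure R := by
    intro w g hw x hx
    refine conj_mem_divisionClosure (Units.map j w) (fun y hy => le_divisionClosure R ?_) hx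
    obtain ⟨a, ha, rfl⟩ := hy
    let c := MulSemiringAction.toRingHom (ConjAct Aˣ) A (ConjAct.toConjAct w)
    have hc : ∀ a, c a = w * a * (w⁻¹ : Aˣ) := fun a => by
      simp [c, ConjAct.units_smul_def]
    suffices Subring.closure (Set.range ι ∪ {x : A | ∃ g : H, g ∈ N ∧ x = (u (g : G) : A)}) ≤
        (R.comap j).comap c by
      have := this ha
      rw [Subring.mem_comap, Subring.mem_comap, hc] at this
      simpa using this
    rw [Subring.closure_le]
    rintro _ (⟨k, rfl⟩ | ⟨h, hh, rfl⟩)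
    · rw [SetLike.mem_coe, Subring.mem_comap, Subring.mem_comap, hc]
      rcases eq_or_ne k 0 with rfl | hk
      · simp
      · obtain ⟨k', hk'⟩ := hA.exists_conj_eq_scalar hw (Units.mk0 k hk)
        have := congrArg Units.val hk'
        simp only [Units.val_mul, Units.coe_map, MonoidHom.coe_coe, Units.val_mk0] at this
        rw [this]
        exact hscalar _
    · rw [SetLike.mem_coe, Subring.mem_comap, Subring.mem_comap, hc]
      exact hmono (w * u h * w⁻¹) (g * h * g⁻¹) (hN.conj_mem h hh g)
        (hA.isMonomial_conj hw (IsMonomial.of_group _))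
  have hpow : ∀ n : ℤ, j (u t) ^ n = j ((u t ^ n : Aˣ) : A) := fun n => by
    have := Units.val_zpow_eq_zpow_val (Units.map (j : A →* D) (u t)) n
    rw [← map_zpow] at this
    exact this.symm
  have hut : ∀ n : ℤ, IsMonomial ι u (u t ^ n) (t ^ n : H) := fun n => by
    simpa using hA.isMonomial_zpow (IsMonomial.of_group (ι := ι) (t : G)) n
  obtain ⟨S, h1, h2, h3⟩ := exists_laurent_expansion (divisionClosureSubfield R) (j (u t))
    ((u t).isUnit.map j).ne_zero
    (fun n x hx => by
      rw [hpow, hpow, zpow_neg]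
      exact hconj _ (t ^ n) (hut n) x hx)
    (fun c hc h0 => hj H N hN t ⟨e⟩ htop c hc h0)
  refine ⟨S, fun k => h1 _ _ ?_, fun g hg => h1 _ _ ?_, h2, h3⟩
  · rw [neg_zero, zpow_zero, mul_one]
    exact le_divisionClosure R (hscalar k)
  · lift g to H using hg
    rw [subgroupDegree_coe, hpow, ← map_mul, ← Units.val_mul]
    refine le_divisionClosure R (hmono _ (g * t ^ (-(φ g).toAdd)) ?_ ?_)
    · rw [← hφN, map_mul, map_zpow, ht, ← ofAdd_zsmul]
      simp
    · rw [Subgroup.coe_mul]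
      exact hA.isMonomial_mul (IsMonomial.of_group _) (hut _)

end Expansion

section Complexity

variable {K G A D₁ D₂ : Type*} [DivisionRing K] [Group G] [Ring A] [DivisionRing D₁]
  [DivisionRing D₂] {ι : K →+* A} {u : G → Aˣ} {j₁ : A →+* D₁} {j₂ : A →+* D₂}
  {p q : Ordinal.{0} → Ordinal.{0}}

/-- Pairs obtained by evaluating one rational expression in both `D₁` and `D₂`, together with a
complexity of the expression and the subgroup supporting it.  Complexities of products and inverses
are governed by `p` and `q`. -/
inductive HasComplexity (ι : K →+* A) (u : G → Aˣ) (j₁ : A →+* D₁) (j₂ : A →+* D₂)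
    (p q : Ordinal.{0} → Ordinal.{0}) : Ordinal.{0} → Subgroup G → D₁ × D₂ → Prop
  | scalar (k : Kˣ) : HasComplexity ι u j₁ j₂ p q 1 ⊥ (j₁.prod j₂ (ι k))
  | add {a b : Ordinal.{0}} {H L : Subgroup G} {x y : D₁ × D₂} {w : Aˣ} {g : G}
      (hx : HasComplexity ι u j₁ j₂ p q a H x) (hy : HasComplexity ι u j₁ j₂ p q b L y)
      (hw : IsMonomial ι u w g) :
      HasComplexity ι u j₁ j₂ p q (naturalSum a b) (H ⊔ L ⊔ Subgroup.zpowers g)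
        (x + y * j₁.prod j₂ w)
  | mul {a b : Ordinal.{0}} {H L : Subgroup G} {x y : D₁ × D₂}
      (hx : HasComplexity ι u j₁ j₂ p q a H x) (hy : HasComplexity ι u j₁ j₂ p q b L y) :
      HasComplexity ι u j₁ j₂ p q (p (naturalSum a b)) (H ⊔ L) (x * y)
  | inv {a : Ordinal.{0}} {H : Subgroup G} {x : D₁ × D₂}
      (hx : HasComplexity ι u j₁ j₂ p q a H x) (h₁ : x.1 ≠ 0) (h₂ : x.2 ≠ 0) :
      HasComplexity ι u j₁ j₂ p q (q a) H x⁻¹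

namespace HasComplexity

variable {a : Ordinal.{0}} {H : Subgroup G} {x : D₁ × D₂}

theorem pos (hp : ∀ a, 1 < p a) (hq : ∀ a, 1 < q a) (h : HasComplexity ι u j₁ j₂ p q a H x) :
    0 < a := by
  induction h with
  | scalar => exact zero_lt_one
  | add _ _ _ ih _ => exact ih.trans_le (le_naturalSum_left _ _)
  | mul => exact zero_lt_one.trans (hp _)
  | inv => exact zero_lt_one.trans (hq _)

theorem fg (h : HasComplexity ι u j₁ j₂ p q a H x) : H.FG := by
  induction h with
  | scalar => exact Subgroup.FG.bot
  | @add _ _ _ _ _ _ _ g _ _ _ ih ih' =>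
    exact (ih.sup ih').sup ⟨{g}, by simp [Subgroup.zpowers_eq_closure]⟩
  | mul _ _ ih ih' => exact ih.sup ih'
  | inv _ _ _ ih => exact ih

theorem exists_eq_scalar (hA : IsCrossedProduct K G A ι u)
    (h : HasComplexity ι u j₁ j₂ p q a H x) (hH : H = ⊥) : ∃ k : K, x = j₁.prod j₂ (ι k) := by
  induction h with
  | scalar k => exact ⟨k, rfl⟩
  | add _ _ hw ih ih' =>
    rw [sup_eq_bot_iff, sup_eq_bot_iff, Subgroup.zpowers_eq_bot] at hH
    obtain ⟨⟨h1, h2⟩, rfl⟩ := hH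
    obtain ⟨k, rfl⟩ := ih h1
    obtain ⟨l, rfl⟩ := ih' h2
    obtain ⟨c, rfl⟩ := hA.eq_scalar_of_isMonomial_one hw
    exact ⟨k + l * c, by simp⟩
  | mul _ _ ih ih' =>
    rw [sup_eq_bot_iff] at hH
    obtain ⟨k, rfl⟩ := ih hH.1
    obtain ⟨l, rfl⟩ := ih' hH.2
    exact ⟨k * l, by simp⟩
  | inv _ _ _ ih =>
    obtain ⟨k, rfl⟩ := ih hH
    exact ⟨k⁻¹, Prod.ext (map_inv₀ (j₁.comp ι) k).symm (map_inv₀ (j₂.comp ι) k).symm⟩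

theorem conj (hA : IsCrossedProduct K G A ι u) {w : Aˣ} {g : G} (hw : IsMonomial ι u w g)
    (h : HasComplexity ι u j₁ j₂ p q a H x) :
    HasComplexity ι u j₁ j₂ p q a (H.map (MulAut.conj g).toMonoidHom)
      (j₁.prod j₂ w * x * j₁.prod j₂ (w⁻¹ : Aˣ)) := by
  have hinv : j₁.prod j₂ (w⁻¹ : Aˣ) * j₁.prod j₂ w = 1 := by
    rw [← map_mul, Units.inv_mul, map_one]
  induction h with
  | scalar k =>
    obtain ⟨k', hk'⟩ := hA.exists_conj_eq_scalar hw k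
    have := congrArg Units.val hk'
    simp only [Units.val_mul, Units.coe_map, MonoidHom.coe_coe] at this
    rw [Subgroup.map_bot, ← map_mul, ← map_mul, this]
    exact scalar k'
  | @add a b H L x y v h hx hy hv ih ih' =>
    have := add ih ih' (hA.isMonomial_conj hw hv)
    rw [Subgroup.map_sup, Subgroup.map_sup, MonoidHom.map_zpowers]
    convert this using 1
    · simp
    · simp only [Units.val_mul, map_mul, mul_add, add_mul, mul_assoc]
      rw [← mul_assoc _ (j₁.prod j₂ w) (_ * _), hinv, one_mul]
  | mul _ _ ih ih' =>
    rw [Subgroup.map_sup]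
    convert mul ih ih' using 1
    simp only [mul_assoc]
    rw [← mul_assoc _ (j₁.prod j₂ w) (_ * _), hinv, one_mul]
  | inv _ h₁ h₂ ih =>
    have hw₁ : j₁ w ≠ 0 := (w.isUnit.map j₁).ne_zero
    have hw₂ : j₂ w ≠ 0 := (w.isUnit.map j₂).ne_zero
    convert inv ih (by simp [h₁, hw₁]) (by simp [h₂, hw₂]) using 1
    ext <;> simp [mul_assoc]

end HasComplexity

end Complexity

section Homogeneous

variable {K G A D₁ D₂ : Type*} [DivisionRing K] [Group G] [Ring A] [DivisionRing D₁]
  [DivisionRing D₂] {ι : K →+* A} {u : G → Aˣ} {j₁ : A →+* D₁} {j₂ : A →+* D₂}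
  {p q : Ordinal.{0} → Ordinal.{0}} {H : Subgroup G} {φ : H →* Multiplicative ℤ}

theorem mem_map_ker_iff {g : G} :
    g ∈ φ.ker.map H.subtype ↔ g ∈ H ∧ subgroupDegree φ g = 0 := by
  constructor
  · rintro ⟨h, hh, rfl⟩
    rw [SetLike.mem_coe, MonoidHom.mem_ker] at hh
    exact ⟨h.2, by rw [Subgroup.subtype_apply, subgroupDegree_coe, hh, toAdd_one]⟩
  · rintro ⟨hg, h⟩
    lift g to H using hg
    rw [subgroupDegree_coe, toAdd_eq_zero] at h
    exact ⟨g, h, rfl⟩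

theorem subgroupDegree_one : subgroupDegree φ 1 = 0 := by
  simpa using subgroupDegree_coe φ 1

theorem subgroupDegree_inv {g : G} (hg : g ∈ H) :
    subgroupDegree φ g⁻¹ = -subgroupDegree φ g := by
  lift g to H using hg
  rw [← Subgroup.coe_inv, subgroupDegree_coe, subgroupDegree_coe, map_inv, toAdd_inv]

theorem map_conj_le_map_ker {g : G} (hg : g ∈ H) {L : Subgroup G}
    (hL : L ≤ φ.ker.map H.subtype) :
    L.map (MulAut.conj g).toMonoidHom ≤ φ.ker.map H.subtype := by
  rintro _ ⟨h, hh, rfl⟩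
  obtain ⟨h1, h2⟩ := mem_map_ker_iff.1 (hL hh)
  have hgh := H.mul_mem hg h1
  refine mem_map_ker_iff.2 ⟨H.mul_mem hgh (H.inv_mem hg), ?_⟩
  simp only [MulEquiv.toMonoidHom_eq_coe, MonoidHom.coe_coe, MulAut.conj_apply]
  rw [subgroupDegree_mul φ _ hgh _ (H.inv_mem hg), subgroupDegree_mul φ _ hg _ h1,
    subgroupDegree_inv hg, h2]
  ring

variable (ι u j₁ j₂ p q φ) in
/-- Pairs of the form `y * w` where `y` has complexity less than `o` and is supported in degree
zero, and `w` is a monomial of degree `n`; the zero pair is included. -/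
def HomogeneousBelow (o : Ordinal.{0}) (n : ℤ) (z : D₁ × D₂) : Prop :=
  z = 0 ∨ ∃ a < o, ∃ (L : Subgroup G) (y : D₁ × D₂) (w : Aˣ) (g : G),
    HasComplexity ι u j₁ j₂ p q a L y ∧ L ≤ φ.ker.map H.subtype ∧ g ∈ H ∧
      subgroupDegree φ g = n ∧ IsMonomial ι u w g ∧ z = y * j₁.prod j₂ w

namespace HomogeneousBelow

variable {o a b : Ordinal.{0}} {n m : ℤ} {z z' : D₁ × D₂}

theorem zero : HomogeneousBelow ι u j₁ j₂ p q φ o n 0 := Or.inl rfl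

theorem mono (h : HomogeneousBelow ι u j₁ j₂ p q φ a n z) (hab : a ≤ b) :
    HomogeneousBelow ι u j₁ j₂ p q φ b n z :=
  h.imp_right fun ⟨a', ha', h⟩ => ⟨a', ha'.trans_le hab, h⟩

theorem monomial (ho : 1 < o) {w : Aˣ} {g : G} (hg : g ∈ H)
    (hw : IsMonomial ι u w g) :
    HomogeneousBelow ι u j₁ j₂ p q φ o (subgroupDegree φ g) (j₁.prod j₂ w) :=
  Or.inr ⟨1, ho, ⊥, _, w, g, .scalar 1, bot_le, hg, rfl, hw, by simp⟩

theorem one (hA : IsCrossedProduct K G A ι u) (ho : 1 < o) :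
    HomogeneousBelow ι u j₁ j₂ p q φ o 0 1 := by
  have := monomial (j₁ := j₁) (j₂ := j₂) (p := p) (q := q) (φ := φ) ho H.one_mem hA.isMonomial_one
  rwa [subgroupDegree_one, Units.val_one, map_one] at this

theorem mul_monomial (hA : IsCrossedProduct K G A ι u)
    (h : HomogeneousBelow ι u j₁ j₂ p q φ a n z) {w : Aˣ} {g : G} (hg : g ∈ H)
    (hw : IsMonomial ι u w g) :
    HomogeneousBelow ι u j₁ j₂ p q φ a (n + subgroupDegree φ g) (z * j₁.prod j₂ w) := by
  rcases h with rfl | ⟨a', ha', L, y, v, g', hy, hL, hg', hn, hv, rfl⟩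
  · rw [zero_mul]; exact zero
  · refine Or.inr ⟨a', ha', L, y, v * w, g' * g, hy, hL, H.mul_mem hg' hg, ?_,
      hA.isMonomial_mul hv hw, by rw [Units.val_mul, map_mul, mul_assoc]⟩
    rw [subgroupDegree_mul φ _ hg' _ hg, hn]

theorem neg (h : HomogeneousBelow ι u j₁ j₂ p q φ a n z) :
    HomogeneousBelow ι u j₁ j₂ p q φ a n (-z) := by
  rcases h with rfl | ⟨a', ha', L, y, w, g, hy, hL, hg, hn, hw, rfl⟩
  · rw [neg_zero]; exact zero
  · exact Or.inr ⟨a', ha', L, y, -w, g, hy, hL, hg, hn, hw.neg,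
      by rw [Units.val_neg, map_neg, mul_neg]⟩

theorem add (hA : IsCrossedProduct K G A ι u) (h : HomogeneousBelow ι u j₁ j₂ p q φ a n z)
    (h' : HomogeneousBelow ι u j₁ j₂ p q φ b n z') (ha : a ≤ o) (hb : b ≤ o)
    (ho : ∀ a' < a, ∀ b' < b, naturalSum a' b' < o) :
    HomogeneousBelow ι u j₁ j₂ p q φ o n (z + z') := by
  rcases h with rfl | ⟨a', ha', L, y, w, g, hy, hL, hg, hn, hw, rfl⟩
  · rw [zero_add]
    exact h'.mono hb
  rcases h' with rfl | ⟨b', hb', L', y', w', g', hy', hL', hg', hn', hw', rfl⟩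
  · rw [add_zero]
    exact Or.inr ⟨a', ha'.trans_le ha, L, y, w, g, hy, hL, hg, hn, hw, rfl⟩
  · refine Or.inr ⟨_, ho a' ha' b' hb', _, _, w, g,
      .add hy hy' (hA.isMonomial_mul hw' (hA.isMonomial_inv hw)), ?_, hg, hn, hw, ?_⟩
    · refine sup_le (sup_le hL hL') ?_
      rw [Subgroup.zpowers_le, mem_map_ker_iff]
      refine ⟨H.mul_mem hg' (H.inv_mem hg), ?_⟩
      rw [subgroupDegree_mul φ _ hg' _ (H.inv_mem hg), subgroupDegree_inv hg, hn, hn',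
        add_neg_cancel]
    · rw [add_mul, mul_assoc, ← map_mul, ← Units.val_mul, inv_mul_cancel_right]

theorem mul (hA : IsCrossedProduct K G A ι u) (h : HomogeneousBelow ι u j₁ j₂ p q φ a n z)
    (h' : HomogeneousBelow ι u j₁ j₂ p q φ b m z')
    (ho : ∀ a' < a, ∀ b' < b, p (naturalSum a' b') < o) :
    HomogeneousBelow ι u j₁ j₂ p q φ o (n + m) (z * z') := by
  rcases h with rfl | ⟨a', ha', L, y, w, g, hy, hL, hg, hn, hw, rfl⟩
  · rw [zero_mul]; exact zero
  rcases h' with rfl | ⟨b', hb', L', y', w', g', hy', hL', hg', hn', hw', rfl⟩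
  · rw [mul_zero]; exact zero
  refine Or.inr ⟨_, ho a' ha' b' hb', _, _, w * w', g * g', .mul hy (hy'.conj hA hw),
    sup_le hL (map_conj_le_map_ker hg hL'), H.mul_mem hg hg', ?_, hA.isMonomial_mul hw hw', ?_⟩
  · rw [subgroupDegree_mul φ _ hg _ hg', hn, hn']
  · rw [Units.val_mul, map_mul]
    simp only [mul_assoc]
    rw [← mul_assoc (j₁.prod j₂ (w⁻¹ : Aˣ)) (j₁.prod j₂ w), ← map_mul, Units.inv_mul, map_one,
      one_mul]

theorem inv (hA : IsCrossedProduct K G A ι u) (h : HomogeneousBelow ι u j₁ j₂ p q φ a n z)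
    (h₁ : z.1 ≠ 0) (h₂ : z.2 ≠ 0) (ho : ∀ a' < a, q a' < o) :
    HomogeneousBelow ι u j₁ j₂ p q φ o (-n) z⁻¹ := by
  rcases h with rfl | ⟨a', ha', L, y, w, g, hy, hL, hg, hn, hw, rfl⟩
  · exact absurd rfl h₁
  refine Or.inr ⟨_, ho a' ha', _, _, w⁻¹, g⁻¹, (hy.inv (left_ne_zero_of_mul h₁)
    (left_ne_zero_of_mul h₂)).conj hA (hA.isMonomial_inv hw), map_conj_le_map_ker (H.inv_mem hg) hL,
    H.inv_mem hg, by rw [subgroupDegree_inv hg, hn], hA.isMonomial_inv hw, ?_⟩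
  have hw₁ : j₁ w ≠ 0 := (w.isUnit.map j₁).ne_zero
  have hw₂ : j₂ w ≠ 0 := (w.isUnit.map j₂).ne_zero
  ext <;> simp [hw₁, hw₂]

theorem sum (hA : IsCrossedProduct K G A ι u) (ho : Ordinal.IsPrincipal naturalSum o)
    {I : Type*} (s : Finset I) (f : I → D₁ × D₂)
    (h : ∀ i ∈ s, HomogeneousBelow ι u j₁ j₂ p q φ o n (f i)) :
    HomogeneousBelow ι u j₁ j₂ p q φ o n (∑ i ∈ s, f i) := by
  classical
  induction s using Finset.induction_on with
  | empty => rw [Finset.sum_empty]; exact zero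
  | insert i s hi ih =>
    rw [Finset.sum_insert hi]
    exact (h i (Finset.mem_insert_self i s)).add hA
      (ih fun k hk => h k (Finset.mem_insert_of_mem hk)) le_rfl le_rfl
      fun a' ha' b' hb' => ho ha' hb'

theorem eq_zero_iff (h : HomogeneousBelow ι u j₁ j₂ p q φ a n z)
    (ha : ∀ b < a, ∀ L y, HasComplexity ι u j₁ j₂ p q b L y → (y.1 = 0 ↔ y.2 = 0)) :
    z.1 = 0 ↔ z.2 = 0 := by
  rcases h with rfl | ⟨a', ha', L, y, w, g, hy, hL, hg, hn, hw, rfl⟩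
  · simp
  · have h₁ : j₁ w ≠ 0 := (w.isUnit.map j₁).ne_zero
    have h₂ : j₂ w ≠ 0 := (w.isUnit.map j₂).ne_zero
    simpa [h₁, h₂] using ha a' ha' L y hy

end HomogeneousBelow

end Homogeneous

section Expands

/-- The recursion for the coefficients of an inverse. -/
theorem HahnSeries.coeff_eq_of_mul_eq_one {D : Type*} [DivisionRing D] (X Y : HahnSeries ℤ D)
    (hXY : X * Y = 1) {m : ℤ} (hX : ∀ i < m, X.coeff i = 0) (hY : ∀ i < -m, Y.coeff i = 0)
    (hm : X.coeff m ≠ 0) (k : ℕ) :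
    Y.coeff (-m + k) = (X.coeff m)⁻¹ * ((if k = 0 then 1 else 0) -
      ∑ i ∈ Finset.Ioc m (m + k), X.coeff i * Y.coeff (k - i)) := by
  have := HahnSeries.coeff_mul_eq_sum_Icc X Y m (m + k) k hX (fun i hi => hY i (by omega))
  rw [hXY, HahnSeries.coeff_one, ← Finset.Ioc_insert_left (by omega),
    Finset.sum_insert (by simp)] at this
  rw [show (-m + k : ℤ) = k - m by ring, eq_inv_mul_iff_mul_eq₀ hm, eq_sub_iff_add_eq, ← this]
  simp

variable {K G A D₁ D₂ : Type*} [DivisionRing K] [Group G] [Ring A] [DivisionRing D₁]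
  [DivisionRing D₂] {ι : K →+* A} {u : G → Aˣ} {j₁ : A →+* D₁} {j₂ : A →+* D₂}
  {p q : Ordinal.{0} → Ordinal.{0}} {H : Subgroup G} {φ : H →* Multiplicative ℤ}
  {S₁ : Subring (D₁ × HahnSeries ℤ D₁)} {S₂ : Subring (D₂ × HahnSeries ℤ D₂)}

theorem IsExpansion.monomial_mem {D : Type*} [DivisionRing D] {j : A →+* D} {deg : G → ℤ}
    {S : Subring (D × HahnSeries ℤ D)} (hS : IsExpansion ι u j H deg S) {w : Aˣ} {g : G}
    (hg : g ∈ H) (hw : IsMonomial ι u w g) :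
    (j w, HahnSeries.single (deg g) (j w)) ∈ S := by
  obtain ⟨c, rfl⟩ := hw
  convert S.mul_mem (hS.scalar_mem c) (hS.group_mem g hg) using 1
  rw [Prod.mk_mul_mk, HahnSeries.single_mul_single]
  simp

theorem IsExpansion.inv_mem {D : Type*} [DivisionRing D] {j : A →+* D} {deg : G → ℤ}
    {S : Subring (D × HahnSeries ℤ D)} (hS : IsExpansion ι u j H deg S) {x : D}
    {X : HahnSeries ℤ D} (h : (x, X) ∈ S) (hx : x ≠ 0) :
    ∃ Y : HahnSeries ℤ D, (x⁻¹, Y) ∈ S ∧ X * Y = 1 := by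
  obtain ⟨⟨y, Y⟩, hY, h1⟩ := hS.exists_mul_eq_one _ h hx
  rw [Prod.mk_mul_mk, Prod.mk_eq_one] at h1
  rw [← eq_inv_of_mul_eq_one_right h1.1]
  exact ⟨Y, hY, h1.2⟩

variable (ι u j₁ j₂ p q φ S₁ S₂) in
/-- Both coordinates of `x` have Laurent expansions, with coefficients forming homogeneous pairs of
complexity below `o`. -/
def ExpandsBelow (o : Ordinal.{0}) (x : D₁ × D₂) : Prop :=
  ∃ (X₁ : HahnSeries ℤ D₁) (X₂ : HahnSeries ℤ D₂), (x.1, X₁) ∈ S₁ ∧ (x.2, X₂) ∈ S₂ ∧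
    ∀ n, HomogeneousBelow ι u j₁ j₂ p q φ o n (X₁.coeff n, X₂.coeff n)

namespace ExpandsBelow

variable {o a b : Ordinal.{0}} {x y : D₁ × D₂}

theorem mono (h : ExpandsBelow ι u j₁ j₂ p q φ S₁ S₂ a x) (hab : a ≤ b) :
    ExpandsBelow ι u j₁ j₂ p q φ S₁ S₂ b x := by
  obtain ⟨X₁, X₂, h₁, h₂, h⟩ := h
  exact ⟨X₁, X₂, h₁, h₂, fun n => (h n).mono hab⟩

theorem of_single (h₁ : (x.1, HahnSeries.single 0 x.1) ∈ S₁)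
    (h₂ : (x.2, HahnSeries.single 0 x.2) ∈ S₂) (h : HomogeneousBelow ι u j₁ j₂ p q φ o 0 x) :
    ExpandsBelow ι u j₁ j₂ p q φ S₁ S₂ o x := by
  refine ⟨_, _, h₁, h₂, fun n => ?_⟩
  rcases eq_or_ne n 0 with rfl | hn
  · simpa using h
  · rw [HahnSeries.coeff_single_of_ne hn, HahnSeries.coeff_single_of_ne hn]
    exact .zero

theorem add (hA : IsCrossedProduct K G A ι u) (hx : ExpandsBelow ι u j₁ j₂ p q φ S₁ S₂ a x)
    (hy : ExpandsBelow ι u j₁ j₂ p q φ S₁ S₂ b y) (ha : a ≤ o) (hb : b ≤ o)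
    (ho : ∀ a' < a, ∀ b' < b, naturalSum a' b' < o) :
    ExpandsBelow ι u j₁ j₂ p q φ S₁ S₂ o (x + y) := by
  obtain ⟨X₁, X₂, h₁, h₂, h⟩ := hx
  obtain ⟨Y₁, Y₂, h₁', h₂', h'⟩ := hy
  exact ⟨X₁ + Y₁, X₂ + Y₂, S₁.add_mem h₁ h₁', S₂.add_mem h₂ h₂', fun n =>
    (h n).add hA (h' n) ha hb ho⟩

theorem mul_monomial (hA : IsCrossedProduct K G A ι u)
    (hS₁ : IsExpansion ι u j₁ H (subgroupDegree φ) S₁)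
    (hS₂ : IsExpansion ι u j₂ H (subgroupDegree φ) S₂)
    (hx : ExpandsBelow ι u j₁ j₂ p q φ S₁ S₂ a x) {w : Aˣ} {g : G} (hg : g ∈ H)
    (hw : IsMonomial ι u w g) :
    ExpandsBelow ι u j₁ j₂ p q φ S₁ S₂ a (x * j₁.prod j₂ w) := by
  obtain ⟨X₁, X₂, h₁, h₂, h⟩ := hx
  refine ⟨_, _, S₁.mul_mem h₁ (hS₁.monomial_mem hg hw), S₂.mul_mem h₂ (hS₂.monomial_mem hg hw),
    fun n => ?_⟩
  have := (h (n - subgroupDegree φ g)).mul_monomial hA hg hw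
  rw [sub_add_cancel] at this
  convert this using 1
  ext
  · simpa using HahnSeries.coeff_mul_single_add (r := j₁ w) (x := X₁)
      (a := n - subgroupDegree φ g) (b := subgroupDegree φ g)
  · simpa using HahnSeries.coeff_mul_single_add (r := j₂ w) (x := X₂)
      (a := n - subgroupDegree φ g) (b := subgroupDegree φ g)

theorem mul (hA : IsCrossedProduct K G A ι u) (hx : ExpandsBelow ι u j₁ j₂ p q φ S₁ S₂ a x)
    (hy : ExpandsBelow ι u j₁ j₂ p q φ S₁ S₂ b y)
    (ho : ∀ a' < a, ∀ b' < b, p (naturalSum a' b') < o) (hop : Ordinal.IsPrincipal naturalSum o) :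
    ExpandsBelow ι u j₁ j₂ p q φ S₁ S₂ o (x * y) := by
  obtain ⟨X₁, X₂, h₁, h₂, h⟩ := hx
  obtain ⟨Y₁, Y₂, h₁', h₂', h'⟩ := hy
  refine ⟨_, _, S₁.mul_mem h₁ h₁', S₂.mul_mem h₂ h₂', fun n => ?_⟩
  have hX : ∀ i < min X₁.order X₂.order, X₁.coeff i = 0 ∧ X₂.coeff i = 0 := fun i hi =>
    ⟨HahnSeries.coeff_eq_zero_of_lt_order (hi.trans_le (min_le_left _ _)),
      HahnSeries.coeff_eq_zero_of_lt_order (hi.trans_le (min_le_right _ _))⟩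
  have hY : ∀ i < min Y₁.order Y₂.order, Y₁.coeff i = 0 ∧ Y₂.coeff i = 0 := fun i hi =>
    ⟨HahnSeries.coeff_eq_zero_of_lt_order (hi.trans_le (min_le_left _ _)),
      HahnSeries.coeff_eq_zero_of_lt_order (hi.trans_le (min_le_right _ _))⟩
  generalize min X₁.order X₂.order = A at hX
  generalize min Y₁.order Y₂.order = B at hY
  have hsum : ((X₁ * Y₁).coeff n, (X₂ * Y₂).coeff n) =
      ∑ i ∈ Finset.Icc A (n - B), (X₁.coeff i, X₂.coeff i) *
        (Y₁.coeff (n - i), Y₂.coeff (n - i)) := by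
    refine Prod.ext ?_ ?_
    · rw [Prod.fst_sum]
      exact HahnSeries.coeff_mul_eq_sum_Icc X₁ Y₁ A (n - B) n (fun i hi => (hX i hi).1)
        fun i hi => (hY i (by simpa using hi)).1
    · rw [Prod.snd_sum]
      exact HahnSeries.coeff_mul_eq_sum_Icc X₂ Y₂ A (n - B) n (fun i hi => (hX i hi).2)
        fun i hi => (hY i (by simpa using hi)).2
  change HomogeneousBelow ι u j₁ j₂ p q φ o n ((X₁ * Y₁).coeff n, (X₂ * Y₂).coeff n)
  rw [hsum]
  refine .sum hA hop _ _ fun i _ => ?_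
  have := (h i).mul hA (h' (n - i)) ho
  rwa [add_sub_cancel] at this

theorem inv (hA : IsCrossedProduct K G A ι u)
    (hS₁ : IsExpansion ι u j₁ H (subgroupDegree φ) S₁)
    (hS₂ : IsExpansion ι u j₂ H (subgroupDegree φ) S₂)
    (hx : ExpandsBelow ι u j₁ j₂ p q φ S₁ S₂ a x) (hx₁ : x.1 ≠ 0) (hx₂ : x.2 ≠ 0)
    (ha : ∀ b < a, ∀ L y, HasComplexity ι u j₁ j₂ p q b L y → (y.1 = 0 ↔ y.2 = 0))
    (hao : a ≤ o) (ho1 : 1 < o) (hq : ∀ b < a, q b < o) (hop : Ordinal.IsPrincipal naturalSum o)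
    (hp : Ordinal.IsPrincipal (fun b c => p (naturalSum b c)) o) :
    ExpandsBelow ι u j₁ j₂ p q φ S₁ S₂ o x⁻¹ := by
  obtain ⟨X₁, X₂, h₁, h₂, h⟩ := hx
  obtain ⟨Y₁, hY₁, hXY₁⟩ := hS₁.inv_mem h₁ hx₁
  obtain ⟨Y₂, hY₂, hXY₂⟩ := hS₂.inv_mem h₂ hx₂
  have hiff : ∀ n, X₁.coeff n = 0 ↔ X₂.coeff n = 0 := fun n => (h n).eq_zero_iff ha
  have hX₁ : X₁ ≠ 0 := left_ne_zero_of_mul_eq_one hXY₁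
  have hX₂ : X₂ ≠ 0 := left_ne_zero_of_mul_eq_one hXY₂
  have horder : X₂.order = X₁.order := le_antisymm
    (HahnSeries.order_le_of_coeff_ne_zero fun h0 =>
      HahnSeries.coeff_order_eq_zero.not.2 hX₁ ((hiff _).2 h0))
    (HahnSeries.order_le_of_coeff_ne_zero fun h0 =>
      HahnSeries.coeff_order_eq_zero.not.2 hX₂ ((hiff _).1 h0))
  have hYorder₁ : Y₁.order = -X₁.order := by
    have := congrArg HahnSeries.order hXY₁
    rw [HahnSeries.order_mul hX₁ (right_ne_zero_of_mul_eq_one hXY₁), HahnSeries.order_one] at this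
    omega
  have hYorder₂ : Y₂.order = -X₁.order := by
    have := congrArg HahnSeries.order hXY₂
    rw [HahnSeries.order_mul hX₂ (right_ne_zero_of_mul_eq_one hXY₂), HahnSeries.order_one] at this
    omega
  have hm₁ : X₁.coeff X₁.order ≠ 0 := HahnSeries.coeff_order_eq_zero.not.2 hX₁
  have hm₂ : X₂.coeff X₁.order ≠ 0 := fun h0 => hm₁ ((hiff _).2 h0)
  have hlt : ∀ i < X₁.order, X₁.coeff i = 0 ∧ X₂.coeff i = 0 := fun i hi =>
    ⟨HahnSeries.coeff_eq_zero_of_lt_order hi,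
      HahnSeries.coeff_eq_zero_of_lt_order (hi.trans_eq horder.symm)⟩
  have hltY : ∀ i < -X₁.order, Y₁.coeff i = 0 ∧ Y₂.coeff i = 0 := fun i hi =>
    ⟨HahnSeries.coeff_eq_zero_of_lt_order (hi.trans_eq hYorder₁.symm),
      HahnSeries.coeff_eq_zero_of_lt_order (hi.trans_eq hYorder₂.symm)⟩
  generalize X₁.order = m at *
  have key : ∀ k : ℕ, HomogeneousBelow ι u j₁ j₂ p q φ o (-m + k)
      (Y₁.coeff (-m + k), Y₂.coeff (-m + k)) := by
    intro k
    induction k using Nat.strong_induction_on with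
    | _ k ih =>
    have hz : (Y₁.coeff (-m + k), Y₂.coeff (-m + k)) =
        (X₁.coeff m, X₂.coeff m)⁻¹ * ((if k = 0 then 1 else 0) -
          ∑ i ∈ Finset.Ioc m (m + k), (X₁.coeff i, X₂.coeff i) *
            (Y₁.coeff (k - i), Y₂.coeff (k - i))) := by
      refine Prod.ext ?_ ?_
      · rw [Prod.fst_mul, Prod.fst_sub, Prod.fst_sum]
        simpa [apply_ite] using
          HahnSeries.coeff_eq_of_mul_eq_one X₁ Y₁ hXY₁ (fun i hi => (hlt i hi).1)
          (fun i hi => (hltY i hi).1) hm₁ k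
      · rw [Prod.snd_mul, Prod.snd_sub, Prod.snd_sum]
        simpa [apply_ite] using
          HahnSeries.coeff_eq_of_mul_eq_one X₂ Y₂ hXY₂ (fun i hi => (hlt i hi).2)
          (fun i hi => (hltY i hi).2) hm₂ k
    rw [hz]
    refine ((h m).inv hA hm₁ hm₂ hq).mul hA ?_ fun b hb c hc => hp hb hc
    rw [sub_eq_add_neg]
    refine HomogeneousBelow.add hA (a := o) (b := o) ?_ (.neg (.sum hA hop _ _ fun i hi => ?_))
      le_rfl le_rfl fun b hb c hc => hop hb hc
    · split_ifs with hk
      · subst hk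
        exact .one hA ho1
      · exact .zero
    · rw [Finset.mem_Ioc] at hi
      have h2 := ih (k - (i - m).toNat) (by omega)
      rw [show (-m + ((k - (i - m).toNat : ℕ) : ℤ)) = k - i by omega] at h2
      have := ((h i).mono hao).mul hA h2 fun b hb c hc => hp hb hc
      rwa [add_sub_cancel] at this
  refine ⟨Y₁, Y₂, hY₁, hY₂, fun n => ?_⟩
  by_cases hn : n < -m
  · rw [(hltY n hn).1, (hltY n hn).2]
    exact .zero
  · have := key (n + m).toNat
    rwa [show (-m + ((n + m).toNat : ℤ)) = n by omega] at this

end ExpandsBelow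

end Expands

section Hughes

/-- The growth conditions on the complexity of products (`p`) and of inverses (`q`) which make the
coefficients of a Laurent expansion less complex than the expanded element. -/
structure IsComplexityGrowth (p q : Ordinal.{0} → Ordinal.{0}) : Prop where
  strictMono_mul : StrictMono p
  one_lt_mul (a : Ordinal.{0}) : 1 < p a
  isPrincipal_mul (a : Ordinal.{0}) : Ordinal.IsPrincipal naturalSum (p a)
  strictMono_inv : StrictMono q
  one_lt_inv (a : Ordinal.{0}) : 1 < q a
  isPrincipal_inv (a : Ordinal.{0}) : Ordinal.IsPrincipal naturalSum (q a)
  isPrincipal_inv_mul (a : Ordinal.{0}) :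
    Ordinal.IsPrincipal (fun b c => p (naturalSum b c)) (q a)

theorem exists_isComplexityGrowth : ∃ p q, IsComplexityGrowth p q := by
  obtain ⟨p, hp, hp'⟩ := exists_strictMono_isPrincipal naturalSum
  obtain ⟨q, hq, hq'⟩ := exists_strictMono_isPrincipal
    fun b c => max (naturalSum b c) (p (naturalSum b c))
  exact ⟨p, q, hp, fun a => (hp' a).1, fun a => (hp' a).2, hq, fun a => (hq' a).1,
    fun a _ _ hb hc => (le_max_left _ _).trans_lt ((hq' a).2 hb hc),
    fun a _ _ hb hc => (le_max_right _ _).trans_lt ((hq' a).2 hb hc)⟩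

variable {K G A D₁ D₂ : Type*} [DivisionRing K] [Group G] [Ring A] [DivisionRing D₁]
  [DivisionRing D₂] {ι : K →+* A} {u : G → Aˣ} {j₁ : A →+* D₁} {j₂ : A →+* D₂}
  {p q : Ordinal.{0} → Ordinal.{0}}

/-- The elements whose Laurent expansion is constant. -/
noncomputable def constantSubring {D : Type*} [DivisionRing D]
    (S : Subring (D × HahnSeries ℤ D)) : Subring D :=
  S.comap ((RingHom.id D).prod HahnSeries.C)

theorem mem_constantSubring {D : Type*} [DivisionRing D] {S : Subring (D × HahnSeries ℤ D)}
    {x : D} : x ∈ constantSubring S ↔ (x, HahnSeries.single 0 x) ∈ S := Iff.rfl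

theorem IsExpansion.inv_mem_constantSubring {D : Type*} [DivisionRing D] {j : A →+* D}
    {H : Subgroup G} {deg : G → ℤ} {S : Subring (D × HahnSeries ℤ D)}
    (hS : IsExpansion ι u j H deg S) {x : D} (hx : x ∈ constantSubring S) :
    x⁻¹ ∈ constantSubring S := by
  rcases eq_or_ne x 0 with rfl | h0
  · simp
  obtain ⟨Y, hY, h⟩ := hS.inv_mem (mem_constantSubring.1 hx) h0
  have : Y = HahnSeries.single 0 x⁻¹ := by
    refine mul_left_cancel₀ (left_ne_zero_of_mul_eq_one h) (h.trans ?_)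
    rw [HahnSeries.single_mul_single, mul_inv_cancel₀ h0]
    simp
  rw [mem_constantSubring, ← this]
  exact hY

/-- A pair supported in `H` is either homogeneous of degree zero, or else all coefficients of its
Laurent expansion are of smaller complexity. -/
theorem HasComplexity.homogeneous_or_expandsBelow (hA : IsCrossedProduct K G A ι u)
    (hpq : IsComplexityGrowth p q) {H : Subgroup G} {φ : H →* Multiplicative ℤ}
    {S₁ : Subring (D₁ × HahnSeries ℤ D₁)} {S₂ : Subring (D₂ × HahnSeries ℤ D₂)}
    (hS₁ : IsExpansion ι u j₁ H (subgroupDegree φ) S₁)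
    (hS₂ : IsExpansion ι u j₂ H (subgroupDegree φ) S₂) {a : Ordinal.{0}} {L : Subgroup G}
    {x : D₁ × D₂} (h : HasComplexity ι u j₁ j₂ p q a L x) (hL : L ≤ H)
    (ha : ∀ b < a, ∀ L y, HasComplexity ι u j₁ j₂ p q b L y → (y.1 = 0 ↔ y.2 = 0)) :
    (L ≤ φ.ker.map H.subtype ∧ x.1 ∈ constantSubring S₁ ∧ x.2 ∈ constantSubring S₂) ∨
    ExpandsBelow ι u j₁ j₂ p q φ S₁ S₂ a x := by
  have hhom : ∀ {a L x}, HasComplexity ι u j₁ j₂ p q a L x → L ≤ φ.ker.map H.subtype →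
      x.1 ∈ constantSubring S₁ → x.2 ∈ constantSubring S₂ →
      ExpandsBelow ι u j₁ j₂ p q φ S₁ S₂ (Order.succ a) x := fun {a L x} hx hL h₁ h₂ =>
    .of_single h₁ h₂ (Or.inr ⟨a, Order.lt_succ a, L, x, 1, 1, hx, hL, H.one_mem, subgroupDegree_one,
      hA.isMonomial_one, by rw [Units.val_one, map_one, mul_one]⟩)
  induction h with
  | scalar k => exact Or.inl ⟨bot_le, hS₁.scalar_mem k, hS₂.scalar_mem k⟩
  | @add a b L L' x y w g hx hy hw ih ih' =>
    have ha0 := hx.pos hpq.one_lt_mul hpq.one_lt_inv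
    have hb0 := hy.pos hpq.one_lt_mul hpq.one_lt_inv
    have hle := le_naturalSum_left a b
    have hle' := le_naturalSum_right a b
    have hsa : Order.succ a ≤ naturalSum a b := Order.succ_le_of_lt
      ((le_naturalSum_left a 0).trans_lt (naturalSum_lt_right a hb0))
    have hsb : Order.succ b ≤ naturalSum a b := Order.succ_le_of_lt
      ((le_naturalSum_right 0 b).trans_lt (naturalSum_lt_left ha0 b))
    have hg : g ∈ H := hL (le_sup_right (a := L ⊔ L') (Subgroup.mem_zpowers g))
    have ih := ih (le_sup_left.trans (le_sup_left.trans hL)) fun c hc => ha c (hc.trans_le hle)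
    have ih' := ih' (le_sup_right.trans (le_sup_left.trans hL)) fun c hc =>
      ha c (hc.trans_le hle')
    rcases ih with ⟨h, h₁, h₂⟩ | h
    · rcases ih' with ⟨h', h₁', h₂'⟩ | h'
      · by_cases hg0 : subgroupDegree φ g = 0
        · refine Or.inl ⟨sup_le (sup_le h h') ?_, ?_, ?_⟩
          · rw [Subgroup.zpowers_le, mem_map_ker_iff]
            exact ⟨hg, hg0⟩
          · refine add_mem h₁ (mul_mem h₁' ?_)
            have := hS₁.monomial_mem hg hw
            rwa [hg0] at this
          · refine add_mem h₂ (mul_mem h₂' ?_)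
            have := hS₂.monomial_mem hg hw
            rwa [hg0] at this
        · right
          have hx' : HomogeneousBelow ι u j₁ j₂ p q φ (naturalSum a b) 0 x :=
            Or.inr ⟨a, hsa.trans_lt' (Order.lt_succ a), L, x, 1, 1, hx, h, H.one_mem,
              subgroupDegree_one, hA.isMonomial_one, by rw [Units.val_one, map_one, mul_one]⟩
          have hy' : HomogeneousBelow ι u j₁ j₂ p q φ (naturalSum a b) (subgroupDegree φ g)
              (y * j₁.prod j₂ w) :=
            Or.inr ⟨b, hsb.trans_lt' (Order.lt_succ b), L', y, w, g, hy, h', hg, rfl, hw, rfl⟩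
          refine ⟨_, _, S₁.add_mem h₁ (S₁.mul_mem h₁' (hS₁.monomial_mem hg hw)),
            S₂.add_mem h₂ (S₂.mul_mem h₂' (hS₂.monomial_mem hg hw)), fun n => ?_⟩
          simp only [RingHom.prod_apply, Prod.mk_mul_mk, HahnSeries.C_apply, RingHom.id_apply,
            HahnSeries.single_mul_single, zero_add, HahnSeries.coeff_add]
          by_cases hn0 : n = 0
          · subst hn0
            rw [HahnSeries.coeff_single_of_ne (Ne.symm hg0),
              HahnSeries.coeff_single_of_ne (Ne.symm hg0)]
            simpa using hx'
          · rw [HahnSeries.coeff_single_of_ne hn0, HahnSeries.coeff_single_of_ne hn0]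
            by_cases hn : n = subgroupDegree φ g
            · subst hn
              rw [HahnSeries.coeff_single_same, HahnSeries.coeff_single_same, zero_add, zero_add]
              exact hy'
            · rw [HahnSeries.coeff_single_of_ne hn, HahnSeries.coeff_single_of_ne hn, add_zero,
                add_zero]
              exact .zero
      · exact Or.inr ((hhom hx h h₁ h₂).add hA (h'.mul_monomial hA hS₁ hS₂ hg hw) hsa hle'
          fun c hc d hd => (naturalSum_mono (Order.lt_succ_iff.1 hc) le_rfl).trans_lt
            (naturalSum_lt_right a hd))
    · have hy' : ExpandsBelow ι u j₁ j₂ p q φ S₁ S₂ (Order.succ b) y := by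
        rcases ih' with ⟨h', h₁', h₂'⟩ | h'
        · exact hhom hy h' h₁' h₂'
        · exact h'.mono (Order.le_succ b)
      exact Or.inr (h.add hA (hy'.mul_monomial hA hS₁ hS₂ hg hw) hle hsb
        fun c hc d hd => (naturalSum_mono le_rfl (Order.lt_succ_iff.1 hd)).trans_lt
          (naturalSum_lt_left hc b))
  | @mul a b L L' x y hx hy ih ih' =>
    have hle : naturalSum a b ≤ p (naturalSum a b) := hpq.strictMono_mul.le_apply
    have ih := ih (le_sup_left.trans hL) fun c hc =>
      ha c (hc.trans_le ((le_naturalSum_left a b).trans hle))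
    have ih' := ih' (le_sup_right.trans hL) fun c hc =>
      ha c (hc.trans_le ((le_naturalSum_right a b).trans hle))
    rcases ih with ⟨h, h₁, h₂⟩ | h
    · rcases ih' with ⟨h', h₁', h₂'⟩ | h'
      · exact Or.inl ⟨sup_le h h', mul_mem h₁ h₁', mul_mem h₂ h₂'⟩
      · exact Or.inr ((hhom hx h h₁ h₂).mul hA h' (fun c hc d hd => hpq.strictMono_mul
          ((naturalSum_mono (Order.lt_succ_iff.1 hc) le_rfl).trans_lt (naturalSum_lt_right a hd)))
          (hpq.isPrincipal_mul _))
    · have hy' : ExpandsBelow ι u j₁ j₂ p q φ S₁ S₂ (Order.succ b) y := by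
        rcases ih' with ⟨h', h₁', h₂'⟩ | h'
        · exact hhom hy h' h₁' h₂'
        · exact h'.mono (Order.le_succ b)
      exact Or.inr (h.mul hA hy' (fun c hc d hd => hpq.strictMono_mul
        ((naturalSum_mono le_rfl (Order.lt_succ_iff.1 hd)).trans_lt (naturalSum_lt_left hc b)))
        (hpq.isPrincipal_mul _))
  | @inv a L x hx hx₁ hx₂ ih =>
    have hle : a ≤ q a := hpq.strictMono_inv.le_apply
    have ha' := fun c (hc : c < a) => ha c (hc.trans_le hle)
    rcases ih hL ha' with ⟨h, h₁, h₂⟩ | h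
    · exact Or.inl ⟨h, hS₁.inv_mem_constantSubring h₁, hS₂.inv_mem_constantSubring h₂⟩
    · exact Or.inr (h.inv hA hS₁ hS₂ hx₁ hx₂ ha' hle (hpq.one_lt_inv a)
        (fun c hc => hpq.strictMono_inv hc) (hpq.isPrincipal_inv a) (hpq.isPrincipal_inv_mul a))

theorem HasComplexity.eq_zero_iff (hG : LocallyIndicable G) (hA : IsCrossedProduct K G A ι u)
    (hj₁ : HughesFree ι u j₁) (hj₂ : HughesFree ι u j₂) (hpq : IsComplexityGrowth p q)
    {a : Ordinal.{0}} {L : Subgroup G} {x : D₁ × D₂} (h : HasComplexity ι u j₁ j₂ p q a L x) :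
    x.1 = 0 ↔ x.2 = 0 := by
  induction a using WellFoundedLT.induction generalizing L x with
  | ind a ih =>
  by_cases hL : L = ⊥
  · obtain ⟨k, rfl⟩ := h.exists_eq_scalar hA hL
    exact (map_eq_zero (j₁.comp ι)).trans (map_eq_zero (j₂.comp ι)).symm
  obtain ⟨N, hN, ⟨e⟩⟩ := hG L hL ((Group.fg_iff_subgroup_fg L).2 h.fg)
  obtain ⟨S₁, hS₁⟩ := hj₁.exists_isExpansion hA L N e
  obtain ⟨S₂, hS₂⟩ := hj₂.exists_isExpansion hA L N e
  rcases h.homogeneous_or_expandsBelow hA hpq hS₁ hS₂ le_rfl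
    (fun b hb L y hy => ih b hb hy) with ⟨hker, -, -⟩ | ⟨X₁, X₂, h₁, h₂, hX⟩
  · exfalso
    obtain ⟨t, ht⟩ := (e.surjective.comp (QuotientGroup.mk'_surjective N)) (Multiplicative.ofAdd 1)
    have h0 := (mem_map_ker_iff.1 (hker t.2)).2
    rw [subgroupDegree_coe, toAdd_eq_zero] at h0
    exact one_ne_zero (ofAdd_eq_one.1 (ht.symm.trans h0))
  · rw [hS₁.eq_zero_iff _ h₁, hS₂.eq_zero_iff _ h₂, HahnSeries.ext_iff, HahnSeries.ext_iff,
      funext_iff, funext_iff]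
    exact forall_congr' fun n => (hX n).eq_zero_iff fun b hb L y hy => ih b hb hy

variable (ι u j₁ j₂ p q) in
/-- The pairs obtained by evaluating rational expressions over the crossed product. -/
def rationalPairs (hA : IsCrossedProduct K G A ι u) : Subring (D₁ × D₂) where
  carrier := {z | ∃ o, HomogeneousBelow ι u j₁ j₂ p q (1 : (⊤ : Subgroup G) →* _) o 0 z}
  zero_mem' := ⟨0, .zero⟩
  one_mem' := ⟨2, .one hA one_lt_two⟩
  neg_mem' := fun ⟨o, h⟩ => ⟨o, h.neg⟩
  add_mem' := fun ⟨a, h⟩ ⟨b, h'⟩ => ⟨naturalSum a b, h.add hA h' (le_naturalSum_left a b)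
    (le_naturalSum_right a b) fun _ hc _ hd =>
      (naturalSum_lt_left hc _).trans (naturalSum_lt_right _ hd)⟩
  mul_mem' := fun ⟨a, h⟩ ⟨b, h'⟩ =>
    ⟨Order.succ (⨆ c : Set.Iio a × Set.Iio b, p (naturalSum c.1 c.2)), by
      simpa using h.mul hA h' fun c hc d hd => Order.lt_succ_of_le
        (Ordinal.le_iSup (fun c : Set.Iio a × Set.Iio b => p (naturalSum c.1 c.2))
          (⟨c, hc⟩, ⟨d, hd⟩))⟩

theorem prod_mem_rationalPairs (hA : IsCrossedProduct K G A ι u) (a : A) :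
    j₁.prod j₂ a ∈ rationalPairs ι u j₁ j₂ p q hA := by
  obtain ⟨d, hd, -⟩ := hA.free a
  rw [hd, Finsupp.sum, map_sum]
  refine sum_mem fun g hg => ⟨2, ?_⟩
  have := HomogeneousBelow.monomial (j₁ := j₁) (j₂ := j₂) (p := p) (q := q)
    (φ := (1 : (⊤ : Subgroup G) →* Multiplicative ℤ)) one_lt_two (Subgroup.mem_top g)
    (⟨Units.mk0 (d g) (Finsupp.mem_support_iff.1 hg), rfl⟩ :
      IsMonomial ι u (Units.map ι (Units.mk0 (d g) (Finsupp.mem_support_iff.1 hg)) * u g) g)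
  simpa [subgroupDegree] using this

theorem inv_mem_rationalPairs (hA : IsCrossedProduct K G A ι u) (hq : StrictMono q)
    {z : D₁ × D₂} (hz : z ∈ rationalPairs ι u j₁ j₂ p q hA) (h₁ : z.1 ≠ 0) (h₂ : z.2 ≠ 0) :
    z⁻¹ ∈ rationalPairs ι u j₁ j₂ p q hA := by
  obtain ⟨o, h⟩ := hz
  exact ⟨q o, by simpa using h.inv hA h₁ h₂ fun b hb => hq hb⟩

/-- A subring of a product of division rings which is closed under inversion, on which the two
coordinates vanish simultaneously, and whose projections generate, is the graph of an
isomorphism. -/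
theorem exists_ringEquiv_of_subring {j₁ : A →+* D₁} {j₂ : A →+* D₂} (Γ : Subring (D₁ × D₂))
    (hj : ∀ a, j₁.prod j₂ a ∈ Γ) (hΓ : ∀ z ∈ Γ, z.1 = 0 ↔ z.2 = 0)
    (hinv : ∀ z ∈ Γ, z.1 ≠ 0 → z.2 ≠ 0 → z⁻¹ ∈ Γ) (h₁ : divisionClosure j₁.range = ⊤)
    (h₂ : divisionClosure j₂.range = ⊤) : ∃ ψ : D₁ ≃+* D₂, ∀ a, ψ (j₁ a) = j₂ a := by
  let π₁ : Γ →+* D₁ := (RingHom.fst D₁ D₂).comp Γ.subtype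
  let π₂ : Γ →+* D₂ := (RingHom.snd D₁ D₂).comp Γ.subtype
  have hi₁ : Function.Injective π₁ := (injective_iff_map_eq_zero π₁).2 fun z hz =>
    Subtype.ext (Prod.ext hz ((hΓ z z.2).1 hz))
  have hi₂ : Function.Injective π₂ := (injective_iff_map_eq_zero π₂).2 fun z hz =>
    Subtype.ext (Prod.ext ((hΓ z z.2).2 hz) hz)
  have hs₁ : Function.Surjective π₁ := by
    rw [← RingHom.range_eq_top, eq_top_iff, ← h₁]
    refine divisionClosure_le ?_ (isDivisionClosed_of_inv_mem ?_)
    · rintro _ ⟨a, rfl⟩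
      exact ⟨⟨_, hj a⟩, rfl⟩
    · rintro _ ⟨z, rfl⟩ h0
      exact ⟨⟨_, hinv z z.2 h0 fun h => h0 ((hΓ z z.2).2 h)⟩, rfl⟩
  have hs₂ : Function.Surjective π₂ := by
    rw [← RingHom.range_eq_top, eq_top_iff, ← h₂]
    refine divisionClosure_le ?_ (isDivisionClosed_of_inv_mem ?_)
    · rintro _ ⟨a, rfl⟩
      exact ⟨⟨_, hj a⟩, rfl⟩
    · rintro _ ⟨z, rfl⟩ h0
      exact ⟨⟨_, hinv z z.2 (fun h => h0 ((hΓ z z.2).1 h)) h0⟩, rfl⟩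
  let e₁ := RingEquiv.ofBijective π₁ ⟨hi₁, hs₁⟩
  let e₂ := RingEquiv.ofBijective π₂ ⟨hi₂, hs₂⟩
  refine ⟨e₁.symm.trans e₂, fun a => ?_⟩
  have : e₁.symm (j₁ a) = ⟨_, hj a⟩ := e₁.symm_apply_eq.2 rfl
  rw [RingEquiv.trans_apply, this]
  rfl

end Hughes

/-- Hughes's theorem: two Hughes-free fields of fractions of a
crossed product `K*G` of a skew field `K` with a locally indicable group `G` are
isomorphic over `K*G`. -/
theorem stmt18 (K : Type) [DivisionRing K] (G : Type) [Group G]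
    (hG : LocallyIndicable G)
    (A : Type) [Ring A] (ι : K →+* A) (u : G → Aˣ)
    (hA : IsCrossedProduct K G A ι u)
    (D₁ D₂ : Type) [DivisionRing D₁] [DivisionRing D₂]
    (j₁ : A →+* D₁) (j₂ : A →+* D₂)
    (hff₁ : IsFieldOfFractions j₁) (hff₂ : IsFieldOfFractions j₂)
    (hhf₁ : HughesFree ι u j₁) (hhf₂ : HughesFree ι u j₂) :
    ∃ ψ : D₁ ≃+* D₂, ∀ a : A, ψ (j₁ a) = j₂ a := by
  obtain ⟨p, q, hpq⟩ := exists_isComplexityGrowth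
  refine exists_ringEquiv_of_subring (rationalPairs ι u j₁ j₂ p q hA) (prod_mem_rationalPairs hA)
    ?_ (fun z hz => inv_mem_rationalPairs hA hpq.strictMono_inv hz) hff₁.2 hff₂.2
  rintro z ⟨o, hz⟩
  exact hz.eq_zero_iff fun b _ L y hy => hy.eq_zero_iff hG hA hhf₁ hhf₂ hpq
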